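/- Let k be a perfect field and let X be a smooth separated scheme of finite type over k. Then X is A¹-rigid if and only if for every finitely generated field extension L of k the map X(L) → X(𝔸¹_L) induced by the projection 𝔸¹_L → Spec L is a bijection, where X(L) denotes the set of k-morphisms Spec L → X and X(𝔸¹_L) the set of k-morphisms 𝔸¹_L → X. -/

import Mathlib

open AlgebraicGeometry CategoryTheory CategoryTheory.Limits

noncomputable section

/-- The morphism `Spec S ⟶ Spec R` induced by a ring homomorphism `R →+* S`. -/
def specMapOf {R S : Type} [CommRing R] [CommRing S] (f : R →+* S) :
    Spec (CommRingCat.of S) ⟶ Spec (CommRingCat.of R) :=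
  Spec.map (CommRingCat.ofHom f)

/-- The structure morphism of the affine line `𝔸¹_k = Spec k[T]` over `k`. -/
def a1Struct (k : Type) [Field k] :
    Spec (CommRingCat.of (Polynomial k)) ⟶ Spec (CommRingCat.of k) :=
  specMapOf (Polynomial.C : k →+* Polynomial k)

/-- A smooth separated finite-type `k`-scheme `X` is *`𝔸¹`-rigid* if for every smooth separated
finite-type `k`-scheme `U` the precomposition with the projection `U ×ₖ 𝔸¹_k ⟶ U` is a
bijection `Hom_k(U, X) → Hom_k(U ×ₖ 𝔸¹_k, X)`. -/
def A1Rigid (k : Type) [Field k] (X : Scheme) (sX : X ⟶ Spec (CommRingCat.of k)) : Prop :=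
  ∀ (U : Scheme) (sU : U ⟶ Spec (CommRingCat.of k)),
    IsSmooth sU → IsSeparated sU → LocallyOfFiniteType sU → QuasiCompact sU →
    ((∀ f g : U ⟶ X, f ≫ sX = sU → g ≫ sX = sU →
        pullback.fst sU (a1Struct k) ≫ f = pullback.fst sU (a1Struct k) ≫ g → f = g) ∧
     (∀ h : pullback sU (a1Struct k) ⟶ X,
        h ≫ sX = pullback.fst sU (a1Struct k) ≫ sU →
        ∃ f : U ⟶ X, f ≫ sX = sU ∧ pullback.fst sU (a1Struct k) ≫ f = h))

/-- An étale algebra over a domain is reduced. -/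
theorem isReduced_of_etale_of_isDomain (R S : Type) [CommRing R] [IsDomain R] [CommRing S]
    [Algebra R S] [Algebra.Etale R S] : IsReduced S := by
  have : IsReduced (TensorProduct R (FractionRing R) S) :=
    Algebra.FormallyUnramified.isReduced_of_field (FractionRing R) _
  have : Module.Flat R S := inferInstance
  exact isReduced_of_injective
    (Algebra.TensorProduct.includeRight : S →ₐ[R] TensorProduct R (FractionRing R) S)
    (Algebra.TensorProduct.includeRight_injective (IsFractionRing.injective R (FractionRing R)))

/-- A smooth algebra over a field is reduced. -/
theorem isReduced_of_algebraSmooth (k A : Type) [Field k] [CommRing A] [Algebra k A]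
    [Algebra.Smooth k A] : IsReduced A := by
  refine isReduced_ofLocalizationMaximal A fun m hm ↦ ?_
  have : Algebra.IsSmoothAt k m :=
    (Algebra.smoothLocus_eq_univ (R := k) (A := A)).ge (Set.mem_univ (⟨m, hm.isPrime⟩ :
      PrimeSpectrum A))
  obtain ⟨f, hf, n, _, _, _⟩ := Algebra.IsSmoothAt.exists_isStandardEtale_mvPolynomial
    (R := k) (p := m)
  have : IsReduced (Localization.Away f) :=
    isReduced_of_etale_of_isDomain (MvPolynomial (Fin n) k) _
  constructor
  rintro x ⟨d, hx⟩
  obtain ⟨a, s, rfl⟩ := IsLocalization.exists_mk'_eq m.primeCompl x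
  rw [← IsLocalization.mk'_pow, IsLocalization.mk'_eq_zero_iff] at hx
  obtain ⟨c, hc⟩ := hx
  have hnil : IsNilpotent (algebraMap A (Localization.Away f) (c * a)) :=
    ⟨d + 1, by
      rw [← map_pow, show ((c : A) * a) ^ (d + 1) = c ^ d * a * (c * a ^ d) by ring, hc, mul_zero,
        map_zero]⟩
  have h0 := hnil.eq_zero
  rw [IsLocalization.map_eq_zero_iff (Submonoid.powers f)] at h0
  obtain ⟨⟨_, n, rfl⟩, h0⟩ := h0
  rw [IsLocalization.mk'_eq_zero_iff]
  refine ⟨⟨f ^ n, fun h ↦ hf (hm.isPrime.mem_of_pow_mem n h)⟩ * c, ?_⟩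
  simpa [mul_assoc] using h0

/-- A scheme smooth over a field is reduced. -/
theorem isReduced_of_smooth_over_field {k : Type} [Field k] {P : Scheme}
    (f : P ⟶ Spec (CommRingCat.of k)) [Smooth f] : AlgebraicGeometry.IsReduced P := by
  have hred : ∀ i, AlgebraicGeometry.IsReduced (P.affineCover.X i) := fun i ↦ by
    obtain ⟨φ, hφ⟩ := Spec.map_surjective (P.affineOpenCover.f i ≫ f)
    have : IsOpenImmersion (P.affineOpenCover.f i) := P.affineOpenCover.map_prop i
    have hs : Smooth (Spec.map φ) := by rw [hφ]; infer_instance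
    have hs := HasRingHomProperty.Spec_iff.mp hs
    let : Algebra k (P.affineOpenCover.X i) := φ.hom.toAlgebra
    have : Algebra.Smooth k (P.affineOpenCover.X i) := RingHom.smooth_algebraMap.mp hs
    have := isReduced_of_algebraSmooth k (P.affineOpenCover.X i)
    exact inferInstanceAs (AlgebraicGeometry.IsReduced (Spec (P.affineOpenCover.X i)))
  exact AlgebraicGeometry.IsReduced.of_openCover P P.affineCover

/-- The residue fields of a scheme locally of finite type over a field are essentially of finite
type. -/
theorem essFiniteType_residueField {k : Type} [Field k] {P : Scheme}
    (f : P ⟶ Spec (CommRingCat.of k)) [LocallyOfFiniteType f] (x : P)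
    (φ : CommRingCat.of k ⟶ P.residueField x)
    (hφ : Spec.map φ = P.fromSpecResidueField x ≫ f) : φ.hom.EssFiniteType := by
  obtain ⟨ψ, hψ⟩ := Spec.map_surjective ((Spec (CommRingCat.of k)).fromSpecStalk (f x))
  rw [Scheme.fromSpecResidueField, Category.assoc, ← Scheme.SpecMap_stalkMap_fromSpecStalk,
    ← hψ, ← Spec.map_comp, ← Spec.map_comp] at hφ
  obtain rfl := Spec.map_injective hφ
  simp only [CommRingCat.hom_comp]
  refine .comp (.comp ?_ (LocallyOfFiniteType.stalkMap f x)) ?_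
  · let y : PrimeSpectrum k := f x
    obtain rfl : ψ = StructureSheaf.toStalk k y :=
      Spec.map_injective (hψ.trans (Spec.fromSpecStalk_eq' _ _))
    have := Algebra.EssFiniteType.of_isLocalization (R := k)
      ((Spec.structureSheaf k).presheaf.stalk y) y.asIdeal.primeCompl
    exact RingHom.essFiniteType_algebraMap.mpr this
  · exact (RingHom.FiniteType.of_surjective _ (P.residue_surjective x)).essFiniteType

/-- The affine line over a `k`-algebra is the base change of the affine line over `k`. -/
theorem isPullback_affineLine (k R : Type) [Field k] [CommRing R] [Algebra k R] :
    IsPullback (specMapOf (Polynomial.C : R →+* Polynomial R))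
      (specMapOf (Polynomial.mapRingHom (algebraMap k R)))
      (specMapOf (algebraMap k R)) (a1Struct k) :=
  letI := Polynomial.algebra k R
  isPullback_SpecMap_of_isPushout _ _ _ _
    (CommRingCat.isPushout_of_isPushout k R (Polynomial k) (Polynomial R))

instance smooth_a1Struct (k : Type) [Field k] : Smooth (a1Struct k) := by
  refine HasRingHomProperty.Spec_iff.mpr ?_
  have : Algebra.FinitePresentation k (Polynomial k) :=
    .equiv (MvPolynomial.uniqueAlgEquiv.{_, 0} k PUnit)
  have : Algebra.Smooth k (Polynomial k) := ⟨inferInstance, inferInstance⟩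
  exact RingHom.smooth_algebraMap.mpr this

theorem specMapOf_comp {R S T : Type} [CommRing R] [CommRing S] [CommRing T]
    (f : R →+* S) (g : S →+* T) : specMapOf g ≫ specMapOf f = specMapOf (g.comp f) := by
  simp [specMapOf, ← Spec.map_comp, ← CommRingCat.ofHom_comp]

theorem specMapOf_id (R : Type) [CommRing R] :
    specMapOf (RingHom.id R) = 𝟙 (Spec (CommRingCat.of R)) := by
  simp [specMapOf]

theorem specMapOf_eval_specMapOf_C {R : Type} [CommRing R] (r : R) :
    specMapOf (Polynomial.evalRingHom r) ≫ specMapOf (Polynomial.C : R →+* Polynomial R) =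
      𝟙 _ := by
  rw [specMapOf_comp, ← specMapOf_id]
  congr 1
  ext
  simp

/-- If all morphisms to `X` from affine lines over finitely generated field extensions of `k`
are constant, then `X` is `𝔸¹`-rigid. -/
theorem a1Rigid_of_exists_specMapOf_C_comp_eq
    {k : Type} [Field k] {X : Scheme} {sX : X ⟶ Spec (CommRingCat.of k)}
    (hXsep : IsSeparated sX)
    (H : ∀ (L : Type) [Field L] [Algebra k L],
        (∃ s : Finset L, IntermediateField.adjoin k (s : Set L) = ⊤) →
        ∀ g : Spec (CommRingCat.of (Polynomial L)) ⟶ X,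
            g ≫ sX = specMapOf ((Polynomial.C : L →+* Polynomial L).comp (algebraMap k L)) →
            ∃ x : Spec (CommRingCat.of L) ⟶ X,
              x ≫ sX = specMapOf (algebraMap k L) ∧
              specMapOf (Polynomial.C : L →+* Polynomial L) ≫ x = g) : A1Rigid k X sX := by
  intro U sU hsm hsep hlft hqc
  have hsm : Smooth sU := hsm
  obtain ⟨z, hz₁, hz₂⟩ : ∃ z : U ⟶ pullback sU (a1Struct k),
      z ≫ pullback.fst sU (a1Struct k) = 𝟙 U ∧
      z ≫ pullback.snd sU (a1Struct k) = sU ≫ specMapOf (Polynomial.evalRingHom 0) :=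
    ⟨pullback.lift (𝟙 U) (sU ≫ specMapOf (Polynomial.evalRingHom 0)) (by
      rw [Category.assoc, a1Struct, specMapOf_eval_specMapOf_C, Category.id_comp,
        Category.comp_id]), pullback.lift_fst _ _ _, pullback.lift_snd _ _ _⟩
  refine ⟨fun f g _ _ hfg ↦ ?_, fun h hh ↦ ⟨z ≫ h, ?_, ?_⟩⟩
  · simpa [reassoc_of% hz₁] using congr(z ≫ $hfg)
  · rw [Category.assoc, hh, reassoc_of% hz₁]
  set p := pullback.fst sU (a1Struct k) with hp
  have hred : AlgebraicGeometry.IsReduced (pullback sU (a1Struct k)) :=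
    isReduced_of_smooth_over_field (p ≫ sU)
  refine ext_of_fromSpecResidueField_eq _ _ (i := sX) (S := Set.univ) dense_univ
    (fun q _ ↦ ?_) ?_
  · let φ := Spec.preimage ((pullback sU (a1Struct k)).fromSpecResidueField q ≫ p ≫ sU)
    have hφ : Spec.map φ = (pullback sU (a1Struct k)).fromSpecResidueField q ≫ p ≫ sU :=
      Spec.map_preimage _
    let K : Type := (pullback sU (a1Struct k)).residueField q
    let : Field K := inferInstanceAs (Field ((pullback sU (a1Struct k)).residueField q))
    let : Algebra k K := φ.hom.toAlgebra
    let s : Spec (CommRingCat.of K) ⟶ pullback sU (a1Struct k) :=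
      (pullback sU (a1Struct k)).fromSpecResidueField q
    have hs : s ≫ p ≫ sU = specMapOf (algebraMap k K) := hφ.symm
    have hK : Algebra.EssFiniteType k K :=
      RingHom.essFiniteType_algebraMap.mp (essFiniteType_residueField (p ≫ sU) q φ hφ)
    obtain ⟨j, hj₁, hj₂⟩ : ∃ j : Spec (CommRingCat.of (Polynomial K)) ⟶ pullback sU (a1Struct k),
        j ≫ p = specMapOf Polynomial.C ≫ s ≫ p ∧
        j ≫ pullback.snd _ _ = specMapOf (Polynomial.mapRingHom (algebraMap k K)) :=
      ⟨pullback.lift (specMapOf Polynomial.C ≫ s ≫ p)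
        (specMapOf (Polynomial.mapRingHom (algebraMap k K))) (by
          rw [Category.assoc, Category.assoc, hs, (isPullback_affineLine k K).w]),
        pullback.lift_fst _ _ _, pullback.lift_snd _ _ _⟩
    obtain ⟨w, hw₁, hw₂⟩ : ∃ w : Spec (CommRingCat.of K) ⟶ Spec (CommRingCat.of (Polynomial K)),
        w ≫ specMapOf Polynomial.C = 𝟙 _ ∧
        w ≫ specMapOf (Polynomial.mapRingHom (algebraMap k K)) = s ≫ pullback.snd _ _ :=
      ⟨(isPullback_affineLine k K).lift (𝟙 _) (s ≫ pullback.snd _ _) (by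
          rw [Category.id_comp, Category.assoc, ← pullback.condition, hs]),
        IsPullback.lift_fst _ _ _ _, IsPullback.lift_snd _ _ _ _⟩
    have hwj : w ≫ j = s := by
      apply pullback.hom_ext
      · rw [Category.assoc, ← hp, hj₁, reassoc_of% hw₁]
      · rw [Category.assoc, hj₂, hw₂]
    have hzj : specMapOf (Polynomial.evalRingHom (0 : K)) ≫ j = s ≫ p ≫ z := by
      apply pullback.hom_ext
      · rw [← hp, Category.assoc, hj₁, ← Category.assoc, specMapOf_eval_specMapOf_C]
        simp only [Category.assoc, hz₁, Category.id_comp, Category.comp_id]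
      · rw [Category.assoc, hj₂, specMapOf_comp, Category.assoc, Category.assoc, hz₂,
          ← Category.assoc p, ← Category.assoc s, hs, specMapOf_comp]
        congr 1
        ext <;> simp
    obtain ⟨x, hx₁, hx₂⟩ := H K (IntermediateField.fg_top_iff.mpr hK) (j ≫ h) (by
      rw [Category.assoc, hh, ← Category.assoc, hj₁, Category.assoc, Category.assoc, hs,
        specMapOf_comp])
    have hx : x = s ≫ p ≫ z ≫ h := by
      have := congr(specMapOf (Polynomial.evalRingHom (0 : K)) ≫ $hx₂)
      rw [← Category.assoc, specMapOf_eval_specMapOf_C, Category.id_comp, ← Category.assoc,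
        hzj] at this
      simpa using this
    have : s ≫ h = x := by
      rw [← hwj, Category.assoc, ← hx₂, reassoc_of% hw₁]
    exact hx.symm.trans this.symm
  · rw [Category.assoc, Category.assoc, hh, reassoc_of% hz₁]

/-- The diagram of polynomial rings over the finitely generated subalgebras of an algebra. -/
def polynomialFGSubalgebra (k L : Type) [Field k] [CommRing L] [Algebra k L] :
    {A : Subalgebra k L // A.FG} ⥤ CommRingCat.{0} where
  obj A := CommRingCat.of (Polynomial A.1)
  map f := CommRingCat.ofHom
    (Polynomial.mapRingHom (Subalgebra.inclusion (leOfHom f)).toRingHom)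
  map_id _ := CommRingCat.hom_ext (RingHom.ext fun _ ↦ Polynomial.map_id)
  map_comp f g := CommRingCat.hom_ext (RingHom.ext fun _ ↦
    (Polynomial.map_map (Subalgebra.inclusion (leOfHom f)).toRingHom
      (Subalgebra.inclusion (leOfHom g)).toRingHom _).symm)

/-- The polynomial ring over an algebra receives compatible maps from the polynomial rings over
its finitely generated subalgebras. -/
def polynomialFGSubalgebraCocone (k L : Type) [Field k] [CommRing L] [Algebra k L] :
    Cocone (polynomialFGSubalgebra k L) where
  pt := CommRingCat.of (Polynomial L)
  ι :=
    { app A := CommRingCat.ofHom (Polynomial.mapRingHom A.1.val.toRingHom)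
      naturality _ _ _ := CommRingCat.hom_ext (RingHom.ext fun _ ↦ Polynomial.map_map _ _ _) }

instance isDirectedOrder_fgSubalgebra (k L : Type) [Field k] [CommRing L] [Algebra k L] :
    IsDirectedOrder {A : Subalgebra k L // A.FG} where
  directed A B := ⟨⟨A.1 ⊔ B.1, A.2.sup B.2⟩, le_sup_left (a := A.1), le_sup_right (a := A.1)⟩

instance nonempty_fgSubalgebra (k L : Type) [Field k] [CommRing L] [Algebra k L] :
    Nonempty {A : Subalgebra k L // A.FG} := ⟨⟨⊥, Subalgebra.fg_bot⟩⟩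

/-- The polynomial ring over an algebra is the colimit of the polynomial rings over its finitely
generated subalgebras. -/
def isColimitPolynomialFGSubalgebraCocone (k L : Type) [Field k] [CommRing L] [Algebra k L] :
    IsColimit (polynomialFGSubalgebraCocone k L) := by
  have : ReflectsColimitsOfShape {A : Subalgebra k L // A.FG} (forget CommRingCat.{0}) :=
    reflectsColimitsOfShape_of_reflectsIsomorphisms
  refine isColimitOfReflects (forget CommRingCat.{0})
    (Types.FilteredColimit.isColimitOf' _ _ (fun p ↦ ?_) fun A p q hpq ↦ ⟨A, 𝟙 A, ?_⟩)
  · classical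
    change Polynomial L at p
    let A : {A : Subalgebra k L // A.FG} :=
      ⟨Algebra.adjoin k (p.coeffs : Set L), Subalgebra.fg_adjoin_finset _⟩
    have hp : p ∈ Polynomial.lifts A.1.val.toRingHom := by
      rw [Polynomial.lifts_iff_coeff_lifts]
      intro n
      by_cases hn : p.coeff n = 0
      · exact ⟨0, by simp [hn]⟩
      · exact ⟨⟨p.coeff n, Algebra.subset_adjoin (p.coeff_mem_coeffs hn)⟩, rfl⟩
    obtain ⟨q, hq⟩ := hp
    exact ⟨A, q, hq.symm⟩
  · have : p = q := Polynomial.map_injective A.1.val.toRingHom Subtype.val_injective hpq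
    rw [this]

/-- A morphism over `k` from the affine line over a `k`-algebra `L` to a scheme locally of finite
presentation over `k` is defined over some finitely generated subalgebra of `L`. -/
theorem exists_fg_affineLine_hom (k L : Type) [Field k] [CommRing L] [Algebra k L]
    {X : Scheme} (sX : X ⟶ Spec (CommRingCat.of k)) [LocallyOfFinitePresentation sX]
    (g : Spec (CommRingCat.of (Polynomial L)) ⟶ X)
    (hg : g ≫ sX = specMapOf ((Polynomial.C : L →+* Polynomial L).comp (algebraMap k L))) :
    ∃ (A : Subalgebra k L) (g' : Spec (CommRingCat.of (Polynomial A)) ⟶ X), A.FG ∧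
      specMapOf (Polynomial.mapRingHom A.val.toRingHom) ≫ g' = g ∧
      g' ≫ sX = specMapOf ((Polynomial.C : A →+* Polynomial A).comp (algebraMap k A)) := by
  let D := (polynomialFGSubalgebra k L).op ⋙ Scheme.Spec
  let c : Cone D := Scheme.Spec.mapCone (polynomialFGSubalgebraCocone k L).op
  have hc : IsLimit c :=
    isLimitOfPreserves Scheme.Spec (isColimitPolynomialFGSubalgebraCocone k L).op
  let t : D ⟶ (Functor.const _).obj (Spec (CommRingCat.of k)) :=
    { app A := specMapOf ((Polynomial.C : A.unop.1 →+* Polynomial A.unop.1).comp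
        (algebraMap k A.unop.1))
      naturality _ _ _ := by
        refine (specMapOf_comp _ _).trans (Eq.trans ?_ (Category.comp_id _).symm)
        exact congrArg specMapOf (RingHom.ext fun _ ↦ Polynomial.map_C _) }
  have h₁ (i j) (f : i ⟶ j) : IsAffineHom (D.map f) := by dsimp [D]; infer_instance
  have h₂ (i) : CompactSpace (D.obj i) := by dsimp [D]; infer_instance
  have h₃ (i) : QuasiSeparatedSpace (D.obj i) := by dsimp [D]; infer_instance
  obtain ⟨A, g', hg₁, hg₂⟩ := Scheme.exists_π_app_comp_eq_of_locallyOfFinitePresentation D t sX c hc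
    g (by
      ext A : 2
      refine (specMapOf_comp _ _).trans (Eq.trans ?_ hg.symm)
      exact congrArg specMapOf (RingHom.ext fun _ ↦ Polynomial.map_C _))
  exact ⟨A.unop.1, g', A.unop.2, hg₁, hg₂⟩

/-- A domain of finite type over a perfect field is generically smooth. -/
theorem exists_ne_zero_smooth_localizationAway (k A : Type) [Field k] [PerfectField k]
    [CommRing A] [IsDomain A] [Algebra k A] [Algebra.FiniteType k A] :
    ∃ f : A, f ≠ 0 ∧ Algebra.Smooth k (Localization.Away f) := by
  have : Algebra.FinitePresentation k A := Algebra.FinitePresentation.of_finiteType.mp inferInstance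
  have : Algebra.IsSmoothAt k (⊥ : Ideal A) := by
    have : IsLocalization (⊥ : Ideal A).primeCompl (FractionRing A) := by
      have : (⊥ : Ideal A).primeCompl = nonZeroDivisors A := by
        ext x
        simp [Ideal.primeCompl]
      rw [this]
      infer_instance
    exact Algebra.FormallySmooth.of_equiv
      ((IsLocalization.algEquiv (⊥ : Ideal A).primeCompl (FractionRing A)
        (Localization.AtPrime (⊥ : Ideal A))).restrictScalars k)
  obtain ⟨f, hf, h⟩ := Algebra.IsSmoothAt.exists_notMem_smooth k (⊥ : Ideal A)
  exact ⟨f, hf, h⟩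

/-- Morphisms from affine lines over field extensions of `k` to an `𝔸¹`-rigid scheme are
constant. -/
theorem A1Rigid.exists_specMapOf_C_comp_eq {k : Type} [Field k] [PerfectField k]
    {X : Scheme} {sX : X ⟶ Spec (CommRingCat.of k)} [LocallyOfFinitePresentation sX]
    (H : A1Rigid k X sX) (L : Type) [Field L] [Algebra k L]
    (g : Spec (CommRingCat.of (Polynomial L)) ⟶ X)
    (hg : g ≫ sX = specMapOf ((Polynomial.C : L →+* Polynomial L).comp (algebraMap k L))) :
    ∃ x : Spec (CommRingCat.of L) ⟶ X, x ≫ sX = specMapOf (algebraMap k L) ∧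
      specMapOf (Polynomial.C : L →+* Polynomial L) ≫ x = g := by
  obtain ⟨A, g', hA, hg₁, hg₂⟩ := exists_fg_affineLine_hom k L sX g hg
  have : Algebra.FiniteType k A := Subalgebra.fg_iff_finiteType A |>.mp hA
  obtain ⟨a, ha, hsm⟩ := exists_ne_zero_smooth_localizationAway k A
  let B := Localization.Away a
  have hu : IsUnit (A.val.toRingHom a) := by simpa using ha
  let ψ : B →+* L := IsLocalization.Away.lift a hu
  have hψ : ψ.comp (algebraMap A B) = A.val.toRingHom := IsLocalization.Away.lift_comp a hu
  have hψk : ψ.comp (algebraMap k B) = algebraMap k L := by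
    rw [IsScalarTower.algebraMap_eq k A B, ← RingHom.comp_assoc, hψ]
    rfl
  let sU : Spec (CommRingCat.of B) ⟶ Spec (CommRingCat.of k) := specMapOf (algebraMap k B)
  have hsU : Smooth sU := HasRingHomProperty.Spec_iff.mpr (RingHom.smooth_algebraMap.mpr hsm)
  have hpb := isPullback_affineLine k B
  obtain ⟨f, hf₁, hf₂⟩ := (H _ sU hsU inferInstance inferInstance inferInstance).2
    (hpb.isoPullback.inv ≫ specMapOf (Polynomial.mapRingHom (algebraMap A B)) ≫ g') (by
      rw [Category.assoc, Category.assoc, hg₂, specMapOf_comp, Iso.inv_comp_eq,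
        hpb.isoPullback_hom_fst_assoc, specMapOf_comp]
      congr 1
      ext x
      simp [IsScalarTower.algebraMap_apply k A B])
  have hf₃ : specMapOf Polynomial.C ≫ f =
      specMapOf (Polynomial.mapRingHom (algebraMap A B)) ≫ g' := by
    rw [← hpb.isoPullback_hom_fst, Category.assoc, hf₂, Iso.hom_inv_id_assoc]
  refine ⟨specMapOf ψ ≫ f, ?_, ?_⟩
  · rw [Category.assoc, hf₁, specMapOf_comp, hψk]
  · have : (Polynomial.C : L →+* Polynomial L).comp ψ =
        (Polynomial.mapRingHom ψ).comp Polynomial.C := by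
      ext
      simp
    rw [← Category.assoc, specMapOf_comp, this, ← specMapOf_comp, Category.assoc, hf₃,
      ← Category.assoc, specMapOf_comp, Polynomial.mapRingHom_comp, hψ, hg₁]

/-- Over a perfect field `k`, a smooth separated finite-type `k`-scheme `X` is `𝔸¹`-rigid if
and only if for every finitely generated field extension `L` of `k` the natural map
`X(L) → X(𝔸¹_L)`, given by precomposition with the projection `𝔸¹_L ⟶ Spec L`, is a
bijection. -/
theorem a1Rigid_iff_finitelyGeneratedFields
    (k : Type) [Field k] [PerfectField k]
    (X : Scheme) (sX : X ⟶ Spec (CommRingCat.of k))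
    (hXsm : IsSmooth sX) (hXsep : IsSeparated sX)
    (hXlft : LocallyOfFiniteType sX) (hXqc : QuasiCompact sX) :
    A1Rigid k X sX ↔
      ∀ (L : Type) [Field L] [Algebra k L],
        (∃ s : Finset L, IntermediateField.adjoin k (s : Set L) = ⊤) →
        ((∀ x y : Spec (CommRingCat.of L) ⟶ X,
            x ≫ sX = specMapOf (algebraMap k L) → y ≫ sX = specMapOf (algebraMap k L) →
            specMapOf (Polynomial.C : L →+* Polynomial L) ≫ x =
              specMapOf (Polynomial.C : L →+* Polynomial L) ≫ y → x = y) ∧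
         (∀ g : Spec (CommRingCat.of (Polynomial L)) ⟶ X,
            g ≫ sX = specMapOf ((Polynomial.C : L →+* Polynomial L).comp (algebraMap k L)) →
            ∃ x : Spec (CommRingCat.of L) ⟶ X,
              x ≫ sX = specMapOf (algebraMap k L) ∧
              specMapOf (Polynomial.C : L →+* Polynomial L) ≫ x = g)) := by
  have hXsm' : Smooth sX := hXsm
  refine ⟨fun H L _ _ _ ↦ ⟨fun x y _ _ hxy ↦ ?_, fun g hg ↦ H.exists_specMapOf_C_comp_eq L g hg⟩,
    fun H ↦ a1Rigid_of_exists_specMapOf_C_comp_eq hXsep fun L _ _ hL ↦ (H L hL).2⟩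
  have := congr(specMapOf (Polynomial.evalRingHom (0 : L)) ≫ $hxy)
  rwa [← Category.assoc, ← Category.assoc, specMapOf_eval_specMapOf_C, Category.id_comp,
    Category.id_comp] at this

end
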